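/- Let m ≥ 1 and let f = Σ_{j=0}^{m} f_j(t) x^j ∈ ℂ[x,t] be monic in x of degree m (f_m = 1) with B_(m) f = 0. Then for every 0 ≤ k ≤ m the degree in t of the coefficient f_k is bounded by deg_t(f_k) ≤ ⌊(m − k)/3⌋; that is, writing m − k = 3q + r with r ∈ {0,1,2}, one has deg(f_k) ≤ q. -/

import Mathlib

open Polynomial

/-- Formal partial derivative with respect to `t` on `ℂ[t][x]`
(outer variable `x`, inner variable `t`). -/
noncomputable def dt (f : Polynomial (Polynomial ℂ)) : Polynomial (Polynomial ℂ) :=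
  f.sum fun n a => Polynomial.C (Polynomial.derivative a) * Polynomial.X ^ n

/-- Formal partial derivative with respect to `x` on `ℂ[t][x]`. -/
noncomputable def dx (f : Polynomial (Polynomial ℂ)) : Polynomial (Polynomial ℂ) :=
  Polynomial.derivative f

/-- The operator `T f = 2 f_{xt} f − 2 f_t f_x + 6 (f_{xx})²`; the generalized bilinear
KdV-type equation is `T f = 0`. -/
noncomputable def Tkdv (f : Polynomial (Polynomial ℂ)) : Polynomial (Polynomial ℂ) :=
  2 * dx (dt f) * f - 2 * dt f * dx f + 6 * (dx (dx f)) ^ 2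

/-- `B_(m) f = 0`: the coefficient of `x^p` in `T f` vanishes for every `p ≥ m − 1`
(equivalently `deg_x (T f) ≤ m − 2`). -/
def Bzero (m : ℕ) (f : Polynomial (Polynomial ℂ)) : Prop :=
  ∀ p : ℕ, m - 1 ≤ p → (Tkdv f).coeff p = 0

theorem coeff_dt (f : Polynomial (Polynomial ℂ)) (n : ℕ) :
    (dt f).coeff n = derivative (f.coeff n) := by
  rw [dt, Polynomial.sum, finsetSum_coeff]
  simp only [coeff_C_mul_X_pow]
  rw [Finset.sum_ite_eq]
  split_ifs with h
  · rfl
  · rw [notMem_support_iff.mp h, derivative_zero]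

theorem derivative_mem_degreeLT {p : Polynomial ℂ} {a : ℕ} (hp : p.natDegree ≤ a) :
    derivative p ∈ degreeLT ℂ a := by
  rw [mem_degreeLT]
  rcases eq_or_ne p 0 with rfl | h
  · simp
  · exact (degree_derivative_lt h).trans_le (natDegree_le_iff_degree_le.mp hp)

theorem natDegree_le_of_derivative_mem_degreeLT {p : Polynomial ℂ} {a : ℕ}
    (hp : derivative p ∈ degreeLT ℂ a) : p.natDegree ≤ a := by
  rw [natDegree_le_iff_coeff_eq_zero]
  intro N hN
  obtain ⟨M, rfl⟩ : ∃ M, N = M + 1 := ⟨N - 1, by omega⟩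
  rw [mem_degreeLT] at hp
  have h : (derivative p).coeff M = 0 :=
    coeff_eq_zero_of_degree_lt (hp.trans_le (by exact_mod_cast Nat.lt_succ_iff.mp hN))
  rw [coeff_derivative] at h
  exact (mul_eq_zero.mp h).resolve_right (by exact_mod_cast M.succ_ne_zero)

theorem mul_mem_degreeLT {p q : Polynomial ℂ} {a b c : ℕ} (hp : p ∈ degreeLT ℂ a)
    (hq : q.natDegree ≤ b) (hc : a + b ≤ c) : p * q ∈ degreeLT ℂ c := by
  rcases eq_or_ne p 0 with rfl | h
  · simp
  · rw [mem_degreeLT, ← natDegree_lt_iff_degree_lt h] at hp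
    rw [mem_degreeLT]
    refine (natDegree_le_iff_degree_le.mp natDegree_mul_le).trans_lt ?_
    exact_mod_cast (by omega : p.natDegree + q.natDegree < c)

theorem natCast_mul_mem_degreeLT {p : Polynomial ℂ} {a : ℕ} (hp : p ∈ degreeLT ℂ a) (c : ℕ) :
    (c : Polynomial ℂ) * p ∈ degreeLT ℂ a := by
  rw [← nsmul_eq_mul]
  exact nsmul_mem hp c

section Weights

variable {m k : ℕ} {f : Polynomial (Polynomial ℂ)}

theorem derivative_coeff_mul_coeff_mem (hdeg : f.natDegree ≤ m) (hmonic : f.coeff m = 1)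
    (ih : ∀ i, k < i → i ≤ m → (f.coeff i).natDegree ≤ (m - i) / 3)
    {i j : ℕ} (hij : i + j = m + k) (hik : i ≠ k) :
    derivative (f.coeff i) * f.coeff j ∈ degreeLT ℂ ((m - k) / 3) := by
  rcases lt_or_ge m i with hi | hi
  · simp [coeff_eq_zero_of_natDegree_lt (hdeg.trans_lt hi)]
  rcases lt_or_ge m j with hj | hj
  · simp [coeff_eq_zero_of_natDegree_lt (hdeg.trans_lt hj)]
  rcases eq_or_lt_of_le hi with rfl | hi'
  · simp [hmonic]
  exact mul_mem_degreeLT (derivative_mem_degreeLT (ih i (by omega) hi)) (ih j (by omega) hj)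
    (by omega)

theorem coeff_mul_coeff_mem (hdeg : f.natDegree ≤ m)
    (ih : ∀ i, k < i → i ≤ m → (f.coeff i).natDegree ≤ (m - i) / 3)
    {i j : ℕ} (hij : i + j = m + k + 3) :
    f.coeff i * f.coeff j ∈ degreeLT ℂ ((m - k) / 3) := by
  rcases lt_or_ge m i with hi | hi
  · simp [coeff_eq_zero_of_natDegree_lt (hdeg.trans_lt hi)]
  rcases lt_or_ge m j with hj | hj
  · simp [coeff_eq_zero_of_natDegree_lt (hdeg.trans_lt hj)]
  have h₁ := ih i (by omega) hi
  have h₂ := ih j (by omega) hj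
  rw [mem_degreeLT]
  refine (natDegree_le_iff_degree_le.mp natDegree_mul_le).trans_lt ?_
  exact_mod_cast (by omega : (f.coeff i).natDegree + (f.coeff j).natDegree < (m - k) / 3)

theorem weighted_sum_sub_mem (hdeg : f.natDegree ≤ m) (hmonic : f.coeff m = 1)
    (ih : ∀ i, k < i → i ≤ m → (f.coeff i).natDegree ≤ (m - i) / 3) (w : ℕ × ℕ → ℕ) :
    ∑ x ∈ Finset.HasAntidiagonal.antidiagonal (m + k), (w x : Polynomial ℂ) *
        (derivative (f.coeff x.1) * f.coeff x.2) -
      (w (k, m) : Polynomial ℂ) * derivative (f.coeff k) ∈ degreeLT ℂ ((m - k) / 3) := by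
  have hmem : (k, m) ∈ Finset.HasAntidiagonal.antidiagonal (m + k) := by simp [add_comm]
  rw [← Finset.add_sum_erase _ _ hmem, hmonic, mul_one, add_sub_cancel_left]
  refine sum_mem fun x hx => natCast_mul_mem_degreeLT ?_ _
  rw [Finset.mem_erase, Finset.HasAntidiagonal.mem_antidiagonal] at hx
  refine derivative_coeff_mul_coeff_mem hdeg hmonic ih hx.2 fun h => hx.1 ?_
  ext
  · exact h
  · have := hx.2
    simp only
    omega

theorem coeff_dx_dt_mul (f : Polynomial (Polynomial ℂ)) (p : ℕ) :
    (dx (dt f) * f).coeff p = ∑ x ∈ Finset.HasAntidiagonal.antidiagonal (p + 1),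
      (x.1 : Polynomial ℂ) * (derivative (f.coeff x.1) * f.coeff x.2) := by
  rw [coeff_mul, Finset.Nat.sum_antidiagonal_succ]
  simp only [dx, coeff_derivative, coeff_dt]
  simp only [Nat.cast_zero, zero_mul, zero_add, Nat.cast_add, Nat.cast_one]
  exact Finset.sum_congr rfl fun x _ => by ring

theorem coeff_dt_mul_dx (f : Polynomial (Polynomial ℂ)) (p : ℕ) :
    (dt f * dx f).coeff p = ∑ x ∈ Finset.HasAntidiagonal.antidiagonal (p + 1),
      (x.2 : Polynomial ℂ) * (derivative (f.coeff x.1) * f.coeff x.2) := by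
  rw [coeff_mul, Finset.Nat.sum_antidiagonal_succ']
  simp only [dx, coeff_derivative, coeff_dt]
  simp only [Nat.cast_zero, zero_mul, zero_add, Nat.cast_add, Nat.cast_one]
  exact Finset.sum_congr rfl fun x _ => by ring

theorem coeff_dx_dx_sq_mem (hdeg : f.natDegree ≤ m)
    (ih : ∀ i, k < i → i ≤ m → (f.coeff i).natDegree ≤ (m - i) / 3)
    {p : ℕ} (hp : p + 1 = m + k) :
    ((dx (dx f)) ^ 2).coeff p ∈ degreeLT ℂ ((m - k) / 3) := by
  rw [sq, coeff_mul]
  refine sum_mem fun x hx => ?_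
  rw [Finset.HasAntidiagonal.mem_antidiagonal] at hx
  have h := natCast_mul_mem_degreeLT (coeff_mul_coeff_mem (i := x.1 + 1 + 1) (j := x.2 + 1 + 1)
    hdeg ih (by omega)) ((x.1 + 1) * (x.1 + 2) * ((x.2 + 1) * (x.2 + 2)))
  convert h using 1
  simp only [dx, coeff_derivative]
  push_cast
  ring

theorem derivative_coeff_mem (hdeg : f.natDegree ≤ m) (hmonic : f.coeff m = 1)
    (hB : Bzero m f) (hk : k < m)
    (ih : ∀ i, k < i → i ≤ m → (f.coeff i).natDegree ≤ (m - i) / 3) :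
    derivative (f.coeff k) ∈ degreeLT ℂ ((m - k) / 3) := by
  obtain ⟨p, hp⟩ : ∃ p, p + 1 = m + k := ⟨m + k - 1, by omega⟩
  have h₁ := weighted_sum_sub_mem hdeg hmonic ih Prod.fst
  have h₂ := weighted_sum_sub_mem hdeg hmonic ih Prod.snd
  have h₃ := natCast_mul_mem_degreeLT (coeff_dx_dx_sq_mem hdeg ih hp) 3
  rw [← hp, ← coeff_dx_dt_mul] at h₁
  rw [← hp, ← coeff_dt_mul_dx] at h₂
  have hT : (dx (dt f) * f).coeff p - (dt f * dx f).coeff p +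
      3 * ((dx (dx f)) ^ 2).coeff p = 0 := by
    have h := hB p (by omega)
    rw [Tkdv, mul_assoc, mul_assoc, coeff_add, coeff_sub] at h
    simp only [coeff_ofNat_mul] at h
    refine mul_left_cancel₀ (two_ne_zero (α := Polynomial ℂ)) ?_
    linear_combination h
  have h := add_mem (sub_mem h₁ h₂) h₃
  obtain ⟨n, rfl⟩ := Nat.exists_eq_add_of_lt hk
  have hsmul : ((n : ℂ) + 1) • derivative (f.coeff k) ∈
      degreeLT ℂ ((k + n + 1 - k) / 3) := by
    convert h using 1
    rw [smul_eq_C_mul]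
    simp only [map_add, map_natCast, map_one]
    push_cast
    linear_combination -hT
  exact ((degreeLT ℂ _).smul_mem_iff (by exact_mod_cast n.succ_ne_zero)).mp hsmul

end Weights

/-- For a monic solution `f = Σ_{j=0}^m f_j(t) x^j` of `B_(m) f = 0`, the `t`-degree of each
coefficient is bounded: `deg_t f_k ≤ ⌊(m − k)/3⌋`. -/
theorem coeff_degree_bound (m : ℕ) (hm : 1 ≤ m) (f : Polynomial (Polynomial ℂ))
    (hdeg : f.natDegree ≤ m) (hmonic : f.coeff m = 1) (hB : Bzero m f) :
    ∀ k : ℕ, k ≤ m → (f.coeff k).natDegree ≤ (m - k) / 3 := by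
  intro k hk
  induction hn : m - k using Nat.strong_induction_on generalizing k with
  | _ n ih =>
    subst hn
    rcases eq_or_lt_of_le hk with rfl | hk'
    · simp [hmonic]
    · exact natDegree_le_of_derivative_mem_degreeLT <|
        derivative_coeff_mem hdeg hmonic hB hk' fun i hi him => ih (m - i) (by omega) i him rfl
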